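/- arXiv:1404.7612 — 2 statements merged into one kernel-verified Lean document; each statement's English description precedes it below -/
import Mathlib

section
/- Let 1<α<2 and define the Wright function Φ_{1/α}(z) = ∑_{m=0}^∞ (−z)^m/(m! Γ(−m/α + 1 − 1/α)). Then there exist constants C,σ>0 such that |Φ_{1/α}(z)| ≤ C exp(−σ z^{α/(α−1)}) for all z ≥ 0. -/
open MeasureTheory Filter Set

/-- The Wright function `Φ_γ(z) = ∑ (-z)^m / (m! Γ(-γm + 1 - γ))`, with the entire
reciprocal Gamma function (Mathlib's `Real.Gamma` vanishes at the poles). -/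
noncomputable def wrightPhiGamma (γ z : ℝ) : ℝ :=
  ∑' m : ℕ, (-z) ^ m / ((m.factorial : ℝ) * Real.Gamma (-γ * m + 1 - γ))

/-- For `1 < α < 2`, the real part of `w ^ α` on the closed first quadrant is bounded by a multiple
of `(re w) ^ α` minus a multiple of `(im w) ^ α`. -/
lemma exists_re_cpow_le {α : ℝ} (hα₁ : 1 < α) (hα₂ : α < 2) :
    ∃ δ : ℝ, 0 < δ ∧ ∃ K : ℝ, 0 < K ∧ ∀ c y : ℝ, 0 ≤ c → 0 ≤ y →
      (((c : ℂ) + y * Complex.I) ^ (α : ℂ)).re ≤ K * c ^ α - δ * y ^ α := by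
  have hcos : Real.cos (Real.pi / 2 * α) < 0 :=
    Real.cos_neg_of_pi_div_two_lt_of_lt (by nlinarith [Real.pi_pos]) (by nlinarith [Real.pi_pos])
  set δ : ℝ := -Real.cos (Real.pi / 2 * α) / 2 with hδ
  have hδ0 : 0 < δ := by rw [hδ]; linarith
  have hcont : ContinuousAt (fun x : ℝ ↦ Real.cos (((x : ℂ) + Complex.I).arg * α)) 0 := by
    have h1 : ContinuousAt (fun x : ℝ ↦ ((x : ℂ) + Complex.I)) 0 := by fun_prop
    have h2 : ContinuousAt Complex.arg (((0 : ℝ) : ℂ) + Complex.I) :=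
      Complex.continuousAt_arg (by simp [Complex.mem_slitPlane_iff])
    have h3 := ContinuousAt.comp (f := fun x : ℝ ↦ ((x : ℂ) + Complex.I)) h2 h1
    exact Real.continuous_cos.continuousAt.comp (h3.mul continuousAt_const)
  have hev : ∀ᶠ x : ℝ in nhds 0, Real.cos (((x : ℂ) + Complex.I).arg * α) < -δ := by
    refine hcont.eventually_lt continuousAt_const ?_
    simp only [Complex.ofReal_zero, zero_add, Complex.arg_I]
    rw [hδ]; linarith
  obtain ⟨η, hη, hball⟩ := Metric.eventually_nhds_iff.mp hev
  have hη' : 0 < η / 2 := by positivity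
  refine ⟨δ, hδ0, (1 + 1 / (η / 2)) ^ α + δ * (1 / (η / 2)) ^ α, by positivity, ?_⟩
  intro c y hc hy
  rw [Complex.cpow_ofReal_re]
  rcases lt_or_ge c (η / 2 * y) with h | h
  · have hy0 : 0 < y := by
      by_contra hcon
      have : y = 0 := by linarith
      subst this; linarith
    have heq : (c : ℂ) + y * Complex.I = (y : ℂ) * (((c / y : ℝ) : ℂ) + Complex.I) := by
      push_cast
      have : (y : ℂ) ≠ 0 := by exact_mod_cast hy0.ne'
      field_simp
    have hc1 : Real.cos (((c : ℂ) + y * Complex.I).arg * α) < -δ := by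
      rw [heq, Complex.arg_real_mul _ hy0]
      apply hball
      rw [dist_zero_right, Real.norm_of_nonneg (by positivity), div_lt_iff₀ hy0]
      nlinarith
    have hn : y ^ α ≤ ‖(c : ℂ) + y * Complex.I‖ ^ α := by
      gcongr
      simpa [abs_of_nonneg hy] using Complex.abs_im_le_norm ((c : ℂ) + y * Complex.I)
    have h0 : 0 ≤ ((1 + 1 / (η / 2)) ^ α + δ * (1 / (η / 2)) ^ α) * c ^ α := by positivity
    have h1 : 0 ≤ y ^ α := by positivity
    nlinarith
  · have hyc : y ≤ 1 / (η / 2) * c := by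
      rw [one_div, inv_mul_eq_div, le_div_iff₀ hη']; linarith
    have hn : ‖(c : ℂ) + y * Complex.I‖ ≤ (1 + 1 / (η / 2)) * c := by
      have := Complex.norm_le_abs_re_add_abs_im ((c : ℂ) + y * Complex.I)
      simp [abs_of_nonneg hy, abs_of_nonneg hc] at this
      simp at hyc ⊢
      linarith
    have h1 : ‖(c : ℂ) + y * Complex.I‖ ^ α ≤ (1 + 1 / (η / 2)) ^ α * c ^ α := by
      rw [← Real.mul_rpow (by positivity) hc]
      gcongr
    have h2 : y ^ α ≤ (1 / (η / 2)) ^ α * c ^ α := by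
      rw [← Real.mul_rpow (by positivity) hc]
      gcongr
    have h3 : ‖(c : ℂ) + y * Complex.I‖ ^ α * Real.cos (((c : ℂ) + y * Complex.I).arg * α)
        ≤ ‖(c : ℂ) + y * Complex.I‖ ^ α :=
      mul_le_of_le_one_right (by positivity) (Real.cos_le_one _)
    nlinarith

lemma integrableOn_exp_neg_mul_rpow {α δ : ℝ} (hα : 0 < α) (hδ : 0 < δ) :
    IntegrableOn (fun y : ℝ ↦ Real.exp (-δ * y ^ α)) (Ioi 0) := by
  simpa using integrableOn_rpow_mul_exp_neg_mul_rpow (s := 0) (by norm_num) hα hδ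

lemma integrableOn_exp_mul_sub_mul_rpow {α δ z : ℝ} (hα : 1 < α) (hδ : 0 < δ) (hz : 0 ≤ z) :
    IntegrableOn (fun y : ℝ ↦ Real.exp (z * y - δ * y ^ α)) (Ioi 0) := by
  set M : ℝ := (2 * z / δ) ^ (1 / (α - 1)) with hM
  have hM0 : 0 ≤ M := by positivity
  have hMpow : M ^ (α - 1) = 2 * z / δ := by
    rw [hM, ← Real.rpow_mul (by positivity), one_div, inv_mul_cancel₀ (by linarith), Real.rpow_one]
  have hbound : ∀ y : ℝ, 0 < y → z * y ≤ δ / 2 * y ^ α + z * M := by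
    intro y hy
    rcases le_total y M with h | h
    · have : 0 ≤ δ / 2 * y ^ α := by positivity
      nlinarith
    · have h1 : M ^ (α - 1) ≤ y ^ (α - 1) := by
        gcongr
      rw [hMpow, div_le_iff₀ hδ] at h1
      have h2 : y ^ α = y ^ (α - 1) * y := by
        rw [← Real.rpow_add_one hy.ne']; simp
      rw [h2]
      have : 0 ≤ z * M := by positivity
      nlinarith
  refine Integrable.mono' ((integrableOn_exp_neg_mul_rpow (α := α) (δ := δ / 2)
    (by linarith) (by positivity)).const_mul (Real.exp (z * M))) (by fun_prop) ?_
  filter_upwards [ae_restrict_mem measurableSet_Ioi] with y hy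
  rw [Real.norm_of_nonneg (Real.exp_pos _).le, ← Real.exp_add]
  gcongr
  linarith [hbound y hy]

/-- The integrand `exp (w ^ α - z w)` of the contour integral representing the Wright function. -/
noncomputable def wrightIntegrand (α z : ℝ) (w : ℂ) : ℂ :=
  Complex.exp (w ^ (α : ℂ) - z * w)

lemma continuousAt_wrightIntegrand {α : ℝ} (hα : 0 < α) (z : ℝ) {w : ℂ} (hw : 0 ≤ w.re) :
    ContinuousAt (wrightIntegrand α z) w := by
  have h : ContinuousAt (fun w : ℂ ↦ w ^ (α : ℂ)) w :=
    Complex.continuousAt_cpow_const_of_re_pos (Or.inl hw) (by simpa)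
  unfold wrightIntegrand
  fun_prop

lemma norm_wrightIntegrand_le {α δ K : ℝ}
    (hK : ∀ c y : ℝ, 0 ≤ c → 0 ≤ y →
      (((c : ℂ) + y * Complex.I) ^ (α : ℂ)).re ≤ K * c ^ α - δ * y ^ α)
    (z : ℝ) {c y : ℝ} (hc : 0 ≤ c) (hy : 0 ≤ y) :
    ‖wrightIntegrand α z (c + y * Complex.I)‖
      ≤ Real.exp (K * c ^ α - z * c) * Real.exp (-δ * y ^ α) := by
  rw [wrightIntegrand, Complex.norm_exp, ← Real.exp_add]
  gcongr
  have := hK c y hc hy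
  simp only [Complex.sub_re, Complex.mul_re, Complex.add_re, Complex.ofReal_re, Complex.I_re,
    Complex.ofReal_im, Complex.I_im]
  linarith

lemma integrableOn_wrightIntegrand {α δ K : ℝ} (hα : 0 < α) (hδ : 0 < δ)
    (hK : ∀ c y : ℝ, 0 ≤ c → 0 ≤ y →
      (((c : ℂ) + y * Complex.I) ^ (α : ℂ)).re ≤ K * c ^ α - δ * y ^ α)
    (z : ℝ) {c : ℝ} (hc : 0 ≤ c) :
    IntegrableOn (fun y : ℝ ↦ wrightIntegrand α z (c + y * Complex.I)) (Ioi 0) := by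
  have hcont : Continuous (fun y : ℝ ↦ wrightIntegrand α z (c + y * Complex.I)) := by
    refine continuous_iff_continuousAt.mpr fun y ↦ ?_
    exact ContinuousAt.comp (f := fun y : ℝ ↦ ((c : ℂ) + y * Complex.I))
      (continuousAt_wrightIntegrand hα z (by simpa)) (by fun_prop)
  refine Integrable.mono' ((integrableOn_exp_neg_mul_rpow hα hδ).const_mul
    (Real.exp (K * c ^ α - z * c))) hcont.aestronglyMeasurable ?_
  filter_upwards [ae_restrict_mem measurableSet_Ioi] with y hy
  exact norm_wrightIntegrand_le hK z hc (le_of_lt hy)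

lemma im_wrightIntegrand_ofReal {α z x : ℝ} (hx : 0 ≤ x) :
    (wrightIntegrand α z x).im = 0 := by
  have : wrightIntegrand α z x = ((Real.exp (x ^ α - z * x) : ℝ) : ℂ) := by
    rw [wrightIntegrand]
    push_cast
    rw [Complex.ofReal_cpow hx]
  rw [this, Complex.ofReal_im]

/-- The vertical contour may be moved to the right without changing the real part. -/
lemma re_integral_wrightIntegrand_eq {α δ K : ℝ} (hα : 0 < α) (hδ : 0 < δ) (hK0 : 0 < K)
    (hK : ∀ c y : ℝ, 0 ≤ c → 0 ≤ y →
      (((c : ℂ) + y * Complex.I) ^ (α : ℂ)).re ≤ K * c ^ α - δ * y ^ α)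
    {z : ℝ} (hz : 0 ≤ z) {c : ℝ} (hc : 0 ≤ c) :
    (∫ y in Ioi (0 : ℝ), wrightIntegrand α z ((c : ℝ) + y * Complex.I)).re
      = (∫ y in Ioi (0 : ℝ), wrightIntegrand α z ((0 : ℝ) + y * Complex.I)).re := by
  set f := wrightIntegrand α z with hf
  have hrect : ∀ Y : ℝ, 0 ≤ Y →
      (∫ y in (0 : ℝ)..Y, f ((c : ℝ) + y * Complex.I)).re
        - (∫ y in (0 : ℝ)..Y, f ((0 : ℝ) + y * Complex.I)).re
      = (∫ x in (0 : ℝ)..c, f (x + Y * Complex.I)).im := by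
    intro Y hY
    have h := Complex.integral_boundary_rect_eq_zero_of_continuousOn_of_differentiableOn
      f 0 ⟨c, Y⟩ ?_ ?_
    · simp only [Complex.zero_re, Complex.zero_im] at h
      have him := congrArg Complex.im h
      have hbot : (∫ x in (0 : ℝ)..c, f (x + (0 : ℝ) * Complex.I)).im = 0 := by
        have hint : IntervalIntegrable (fun x : ℝ ↦ f (x + (0 : ℝ) * Complex.I)) volume 0 c := by
          refine ContinuousOn.intervalIntegrable fun x hx ↦ ?_
          rw [uIcc_of_le hc] at hx
          refine ContinuousAt.continuousWithinAt ?_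
          exact ContinuousAt.comp (f := fun x : ℝ ↦ ((x : ℂ) + (0 : ℝ) * Complex.I))
            (continuousAt_wrightIntegrand hα z (by simpa using hx.1)) (by fun_prop)
        have := Complex.imCLM.intervalIntegral_comp_comm hint
        simp only [Complex.imCLM_apply] at this
        rw [← this]
        refine intervalIntegral.integral_zero_ae (ae_of_all _ fun x hx ↦ ?_)
        rw [uIoc_of_le hc] at hx
        simpa using im_wrightIntegrand_ofReal hx.1.le
      simp only [Complex.add_im, Complex.sub_im, smul_eq_mul, Complex.mul_im, Complex.I_re,
        Complex.I_im, Complex.zero_im, hbot] at him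
      linarith
    · intro w hw
      rw [Complex.mem_reProdIm] at hw
      simp only [Complex.zero_re, uIcc_of_le hc] at hw
      exact (continuousAt_wrightIntegrand hα z hw.1.1).continuousWithinAt
    · intro w hw
      rw [Complex.mem_reProdIm] at hw
      simp only [Complex.zero_re, min_eq_left hc] at hw
      have hs : w ∈ Complex.slitPlane := Or.inl hw.1.1
      refine DifferentiableAt.differentiableWithinAt ?_
      have : DifferentiableAt ℂ (fun w : ℂ ↦ w ^ (α : ℂ)) w :=
        differentiableAt_id.cpow_const hs
      rw [hf]
      unfold wrightIntegrand
      fun_prop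
  have htop : Tendsto (fun Y : ℝ ↦ (∫ x in (0 : ℝ)..c, f (x + Y * Complex.I)).im)
      atTop (nhds 0) := by
    have hlim : Tendsto (fun Y : ℝ ↦ Real.exp (K * c ^ α) * Real.exp (-δ * Y ^ α) * |c - 0|)
        atTop (nhds 0) := by
      have h1 : Tendsto (fun Y : ℝ ↦ -δ * Y ^ α) atTop atBot :=
        (tendsto_rpow_atTop hα).const_mul_atTop_of_neg (by linarith)
      simpa using ((Real.tendsto_exp_atBot.comp h1).const_mul (Real.exp (K * c ^ α))).mul_const
        |c - 0|
    refine squeeze_zero_norm' ?_ hlim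
    filter_upwards [eventually_ge_atTop (0 : ℝ)] with Y hY
    refine (Complex.abs_im_le_norm _).trans ?_
    refine intervalIntegral.norm_integral_le_of_norm_le_const fun x hx ↦ ?_
    rw [uIoc_of_le hc] at hx
    refine (norm_wrightIntegrand_le hK z hx.1.le hY).trans ?_
    have h1 : x ^ α ≤ c ^ α := Real.rpow_le_rpow hx.1.le hx.2 hα.le
    have h2 : 0 ≤ z * x := mul_nonneg hz hx.1.le
    gcongr
    nlinarith
  have hvert : ∀ c : ℝ, 0 ≤ c → Tendsto
      (fun Y : ℝ ↦ (∫ y in (0 : ℝ)..Y, f ((c : ℝ) + y * Complex.I)).re) atTop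
      (nhds (∫ y in Ioi (0 : ℝ), f ((c : ℝ) + y * Complex.I)).re) := fun c hc ↦
    (Complex.continuous_re.tendsto _).comp (intervalIntegral_tendsto_integral_Ioi 0
      (integrableOn_wrightIntegrand hα hδ hK z hc) tendsto_id)
  have hdiff := (hvert c hc).sub (hvert 0 le_rfl)
  have := tendsto_nhds_unique_of_eventuallyEq hdiff htop (by
    filter_upwards [eventually_ge_atTop (0 : ℝ)] with Y hY using hrect Y hY)
  linarith

lemma integral_cexp_neg_mul_rpow {p : ℝ} (hp : 0 < p) {b : ℂ} (hb : 0 < b.re) :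
    ∫ u in Ioi (0 : ℝ), Complex.exp (-b * (u ^ p : ℝ))
      = b ^ ((-1 / p : ℝ) : ℂ) * Real.Gamma (1 / p + 1) := by
  set μ : Measure ℝ := volume.restrict (Ioi 0) with hμ
  set X : ℝ → ℝ := fun u ↦ u ^ p with hX
  have hsub : Iio (0 : ℝ) ⊆ interior (ProbabilityTheory.integrableExpSet X μ) := by
    refine interior_maximal (fun t ht ↦ ?_) isOpen_Iio
    have h := integrableOn_exp_neg_mul_rpow hp (neg_pos.mpr ht)
    rwa [neg_neg] at h
  have hf : AnalyticOnNhd ℂ (ProbabilityTheory.complexMGF X μ) {z | z.re < 0} :=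
    ProbabilityTheory.analyticOnNhd_complexMGF.mono fun z hz ↦ hsub hz
  have hg : AnalyticOnNhd ℂ (fun z : ℂ ↦ (-z) ^ ((-1 / p : ℝ) : ℂ) * Real.Gamma (1 / p + 1))
      {z | z.re < 0} := by
    refine DifferentiableOn.analyticOnNhd (fun z hz ↦ ?_)
      (isOpen_lt Complex.continuous_re continuous_const)
    have hz' : -z ∈ Complex.slitPlane := Or.inl (by simpa using hz)
    exact ((differentiableAt_id.neg.cpow_const hz').mul_const _).differentiableWithinAt
  have hU : IsPreconnected {z : ℂ | z.re < 0} := (convex_halfSpace_re_lt 0).isPreconnected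
  have hreal : ∀ t : ℝ, t < 0 → ProbabilityTheory.complexMGF X μ t
      = (-(t : ℂ)) ^ ((-1 / p : ℝ) : ℂ) * Real.Gamma (1 / p + 1) := by
    intro t ht
    rw [ProbabilityTheory.complexMGF_ofReal, ProbabilityTheory.mgf]
    have := integral_exp_neg_mul_rpow hp (neg_pos.mpr ht)
    rw [neg_neg] at this
    rw [hμ, hX, this, ← Complex.ofReal_neg, ← Complex.ofReal_cpow (by linarith)]
    push_cast
    rfl
  have hfreq : ∃ᶠ z : ℂ in nhdsWithin (((-1 : ℝ) : ℂ)) {((-1 : ℝ) : ℂ)}ᶜ,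
      ProbabilityTheory.complexMGF X μ z
        = (-z) ^ ((-1 / p : ℝ) : ℂ) * Real.Gamma (1 / p + 1) := by
    have hev : ∀ᶠ t : ℝ in nhdsWithin (-1) {-1}ᶜ, t < 0 :=
      nhdsWithin_le_nhds (Iio_mem_nhds (by norm_num))
    have htend : Tendsto (fun t : ℝ ↦ (t : ℂ)) (nhdsWithin (-1) {-1}ᶜ)
        (nhdsWithin (((-1 : ℝ) : ℂ)) {((-1 : ℝ) : ℂ)}ᶜ) := by
      refine tendsto_nhdsWithin_iff.mpr
        ⟨(Complex.continuous_ofReal.tendsto _).mono_left nhdsWithin_le_nhds, ?_⟩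
      filter_upwards [self_mem_nhdsWithin] with t ht
      simpa using fun h : (t : ℂ) = -1 ↦ ht (by exact_mod_cast h)
    exact htend.frequently (hev.mono fun t ht ↦ hreal t ht).frequently
  have := hf.eqOn_of_preconnected_of_frequently_eq hg hU
    (z₀ := ((-1 : ℝ) : ℂ)) (by simp) hfreq (x := -b) (by simpa using hb)
  simpa [ProbabilityTheory.complexMGF] using this

lemma integral_pow_mul_cexp_neg_mul_rpow {α : ℝ} (hα : 0 < α) {b : ℂ} (hb : 0 < b.re) (m : ℕ) :
    ∫ y in Ioi (0 : ℝ), (y : ℂ) ^ m * Complex.exp (-b * (y ^ α : ℝ))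
      = b ^ ((-((m + 1) / α) : ℝ) : ℂ) * (Real.Gamma ((m + 1) / α) / α : ℝ) := by
  have hm : (0 : ℝ) < m + 1 := by positivity
  have h1 := integral_comp_rpow_Ioi_of_pos
    (g := fun u : ℝ ↦ Complex.exp (-b * (u ^ (α / (m + 1)) : ℝ))) hm
  rw [integral_cexp_neg_mul_rpow (by positivity) hb] at h1
  have h2 : ∫ x in Ioi (0 : ℝ), (((m : ℝ) + 1) * x ^ ((m : ℝ) + 1 - 1)) •
      Complex.exp (-b * ((x ^ ((m : ℝ) + 1)) ^ (α / (m + 1)) : ℝ))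
      = ((m : ℂ) + 1) * ∫ y in Ioi (0 : ℝ), (y : ℂ) ^ m * Complex.exp (-b * (y ^ α : ℝ)) := by
    rw [← integral_const_mul]
    refine setIntegral_congr_fun measurableSet_Ioi fun x hx ↦ ?_
    have hx' : 0 < x := hx
    rw [← Real.rpow_mul hx'.le, mul_div_cancel₀ _ hm.ne', add_sub_cancel_right, Real.rpow_natCast,
      Complex.real_smul]
    push_cast
    ring
  rw [h2] at h1
  have hm' : (m : ℂ) + 1 ≠ 0 := by exact_mod_cast hm.ne'
  rw [← mul_right_inj' hm', h1, one_div_div, Real.Gamma_add_one (by positivity)]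
  have : (-1 / (α / ((m : ℝ) + 1))) = -((m + 1) / α) := by field_simp
  rw [this]
  have hα' : (α : ℂ) ≠ 0 := by exact_mod_cast hα.ne'
  push_cast
  field_simp

lemma inv_Gamma_one_sub {s : ℝ} (hs : 0 < s) :
    (Real.Gamma (1 - s))⁻¹ = Real.Gamma s * Real.sin (Real.pi * s) / Real.pi := by
  have h := Real.Gamma_mul_Gamma_one_sub s
  have hG := (Real.Gamma_pos_of_pos hs).ne'
  rw [mul_comm, ← eq_div_iff hG] at h
  rw [h, inv_div, div_div_eq_mul_div]

lemma hasSum_integral_pow_div_factorial_mul_cexp {α : ℝ} (hα : 1 < α) {b : ℂ} (hb : 0 < b.re)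
    {z : ℝ} (hz : 0 ≤ z) :
    HasSum (fun m : ℕ ↦ ∫ y in Ioi (0 : ℝ),
      (-(z * y * Complex.I)) ^ m / (m.factorial : ℂ) * Complex.exp (-b * (y ^ α : ℝ)))
      (∫ y in Ioi (0 : ℝ),
        Complex.exp (-(z * y * Complex.I)) * Complex.exp (-b * (y ^ α : ℝ))) := by
  have hexp : ∀ y : ℝ, HasSum (fun m : ℕ ↦ (z * y) ^ m / (m.factorial : ℝ)
      * Real.exp (-b.re * y ^ α)) (Real.exp (z * y - b.re * y ^ α)) := by
    intro y
    have := (NormedSpace.expSeries_div_hasSum_exp (z * y)).mul_right (Real.exp (-b.re * y ^ α))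
    rwa [← Real.exp_eq_exp_ℝ, ← Real.exp_add, show z * y + -b.re * y ^ α = z * y - b.re * y ^ α by ring]
      at this
  refine hasSum_integral_of_dominated_convergence
    (fun m y ↦ (z * y) ^ m / (m.factorial : ℝ) * Real.exp (-b.re * y ^ α)) ?_ ?_ ?_ ?_ ?_
  · intro m
    exact Measurable.aestronglyMeasurable (by fun_prop)
  · intro m
    filter_upwards [ae_restrict_mem measurableSet_Ioi] with y hy
    have hy' : 0 < y := hy
    refine le_of_eq ?_
    rw [norm_mul, norm_div, norm_pow, norm_neg, norm_mul, norm_mul, Complex.norm_I, mul_one,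
      Complex.norm_of_nonneg hz, Complex.norm_of_nonneg hy'.le, Complex.norm_natCast,
      Complex.norm_exp, Complex.re_mul_ofReal, Complex.neg_re]
  · exact ae_of_all _ fun y ↦ (hexp y).summable
  · simp_rw [fun y ↦ (hexp y).tsum_eq]
    exact integrableOn_exp_mul_sub_mul_rpow hα hb hz
  · refine ae_of_all _ fun y ↦ ?_
    have h := NormedSpace.expSeries_div_hasSum_exp (-((z : ℂ) * y * Complex.I))
    rw [← Complex.exp_eq_exp_ℂ] at h
    exact h.mul_right _

/-- The Wright function as an integral along the imaginary axis. -/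
lemma wrightPhiGamma_eq_re_integral {α : ℝ} (hα₁ : 1 < α) (hα₂ : α < 2) {z : ℝ} (hz : 0 ≤ z) :
    wrightPhiGamma (1 / α) z = α / Real.pi *
      (∫ y in Ioi (0 : ℝ), wrightIntegrand α z ((0 : ℝ) + y * Complex.I)).re := by
  have hα0 : 0 < α := by linarith
  have hπ := Real.pi_pos
  set θ : ℝ := Real.pi * (α / 2 - 1) with hθ
  set b : ℂ := Complex.exp (θ * Complex.I) with hb
  have hθ1 : -(Real.pi / 2) < θ := by rw [hθ]; nlinarith
  have hθ2 : θ < 0 := by rw [hθ]; nlinarith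
  have hbre : b.re = Real.cos θ := Complex.exp_ofReal_mul_I_re θ
  have hbpos : 0 < b.re := by
    rw [hbre]
    exact Real.cos_pos_of_mem_Ioo ⟨hθ1, by linarith⟩
  have hlog : Complex.log b = θ * Complex.I :=
    Complex.log_exp (by simp; linarith) (by simp; linarith)
  have hIα : Complex.I ^ (α : ℂ) = -b := by
    rw [Complex.cpow_def_of_ne_zero Complex.I_ne_zero, Complex.log_I, hb, hθ]
    have : ((Real.pi * (α / 2 - 1) : ℝ) : ℂ) * Complex.I
        = Real.pi / 2 * Complex.I * α - Real.pi * Complex.I := by push_cast; ring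
    rw [this, Complex.exp_sub, Complex.exp_pi_mul_I, div_neg, div_one, neg_neg]
  have hterm : ∀ y : ℝ, 0 < y → wrightIntegrand α z ((0 : ℝ) + y * Complex.I)
      = Complex.exp (-(z * y * Complex.I)) * Complex.exp (-b * (y ^ α : ℝ)) := by
    intro y hy
    rw [wrightIntegrand, ← Complex.exp_add, Complex.ofReal_zero, zero_add,
      Complex.cpow_def_of_ne_zero (by simp [hy.ne']), Complex.log_ofReal_mul hy Complex.I_ne_zero,
      add_mul, Complex.exp_add, Complex.ofReal_log hy.le,
      ← Complex.cpow_def_of_ne_zero (by simp [hy.ne']),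
      ← Complex.cpow_def_of_ne_zero Complex.I_ne_zero, hIα, Complex.ofReal_cpow hy.le]
    congr 1
    ring
  rw [setIntegral_congr_fun measurableSet_Ioi hterm]
  have hre := (Complex.hasSum_re
    (hasSum_integral_pow_div_factorial_mul_cexp hα₁ hbpos hz)).mul_left (α / Real.pi)
  rw [← hre.tsum_eq, wrightPhiGamma]
  refine tsum_congr fun m ↦ ?_
  set s : ℝ := (m + 1) / α with hs
  have hs0 : 0 < s := by positivity
  have hint : ∫ y in Ioi (0 : ℝ),
      (-(z * y * Complex.I)) ^ m / (m.factorial : ℂ) * Complex.exp (-b * (y ^ α : ℝ))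
      = (((-z) ^ m / m.factorial * (Real.Gamma s / α) : ℝ) : ℂ)
        * Complex.exp ((Real.pi * s - Real.pi / 2 : ℝ) * Complex.I) := by
    have h1 : ∀ y : ℝ, (-(z * y * Complex.I)) ^ m / (m.factorial : ℂ)
          * Complex.exp (-b * (y ^ α : ℝ))
        = ((-z : ℂ) ^ m * Complex.I ^ m / m.factorial)
          * ((y : ℂ) ^ m * Complex.exp (-b * (y ^ α : ℝ))) := by
      intro y
      rw [show -(z * y * Complex.I) = (-z : ℂ) * Complex.I * y by ring, mul_pow, mul_pow]
      ring
    simp_rw [h1]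
    rw [integral_const_mul, integral_pow_mul_cexp_neg_mul_rpow hα0 hbpos, ← hs,
      Complex.cpow_def_of_ne_zero (Complex.exp_ne_zero _), hlog]
    have hI : Complex.I ^ m = Complex.exp (m * (Real.pi / 2 * Complex.I)) := by
      rw [Complex.exp_nat_mul, Complex.exp_pi_div_two_mul_I]
    have hangle : Complex.exp ((Real.pi * s - Real.pi / 2 : ℝ) * Complex.I)
        = Complex.I ^ m * Complex.exp (θ * Complex.I * ((-s : ℝ) : ℂ)) := by
      rw [hI, ← Complex.exp_add]
      congr 1
      have : Real.pi * s - Real.pi / 2 = m * (Real.pi / 2) + θ * (-s) := by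
        rw [hθ, hs]; field_simp; ring
      rw [this]
      push_cast
      ring
    rw [hangle]
    push_cast
    ring
  rw [hint, Complex.re_ofReal_mul, Complex.exp_ofReal_mul_I_re, Real.cos_sub_pi_div_two,
    show -(1 / α) * m + 1 - 1 / α = 1 - s by rw [hs]; field_simp; ring, div_eq_mul_inv, mul_inv,
    inv_Gamma_one_sub hs0]
  field_simp

/-- For `1 < α < 2`, the Wright function `Φ_{1/α}` satisfies the exponential decay bound
`|Φ_{1/α}(z)| ≤ C exp(-σ z^{α/(α-1)})` for `z ≥ 0`. -/
theorem wright_exponential_decay (α : ℝ) (hα₁ : 1 < α) (hα₂ : α < 2) :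
    ∃ C : ℝ, 0 < C ∧ ∃ σ : ℝ, 0 < σ ∧ ∀ z : ℝ, 0 ≤ z →
      |wrightPhiGamma (1 / α) z| ≤ C * Real.exp (-σ * z ^ (α / (α - 1))) := by
  have hα0 : 0 < α := by linarith
  have hα1 : 0 < α - 1 := by linarith
  obtain ⟨δ, hδ, K, hK0, hK⟩ := exists_re_cpow_le hα₁ hα₂
  set ε : ℝ := (1 / (2 * K)) ^ (1 / (α - 1)) with hε
  have hε0 : 0 < ε := by positivity
  have hεpow : K * ε ^ α = ε / 2 := by
    have h1 : ε ^ (α - 1) = 1 / (2 * K) := by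
      rw [hε, ← Real.rpow_mul (by positivity), one_div_mul_cancel hα1.ne', Real.rpow_one]
    have h2 : ε ^ α = ε ^ (α - 1) * ε := by
      rw [← Real.rpow_add_one hε0.ne']; simp
    rw [h2, h1]
    field_simp
  set J : ℝ := ∫ y in Ioi (0 : ℝ), Real.exp (-δ * y ^ α) with hJ
  have hJ0 : 0 ≤ J := integral_nonneg fun y ↦ (Real.exp_pos _).le
  have hπ := Real.pi_pos
  refine ⟨α / Real.pi * (J + 1), by positivity, ε / 2, by positivity, fun z hz ↦ ?_⟩
  set c : ℝ := ε * z ^ (1 / (α - 1)) with hc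
  have hc0 : 0 ≤ c := by positivity
  have hexponent : K * c ^ α - z * c = -(ε / 2) * z ^ (α / (α - 1)) := by
    have h1 : c ^ α = ε ^ α * z ^ (α / (α - 1)) := by
      rw [hc, Real.mul_rpow hε0.le (by positivity), ← Real.rpow_mul hz]
      congr 2
      ring
    have h2 : z * z ^ (1 / (α - 1)) = z ^ (α / (α - 1)) := by
      rw [← Real.rpow_one_add' hz (by positivity)]
      congr 1
      field_simp
      ring
    rw [h1, ← mul_assoc, hεpow, hc, mul_left_comm, h2]
    ring
  rw [wrightPhiGamma_eq_re_integral hα₁ hα₂ hz,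
    ← re_integral_wrightIntegrand_eq hα0 hδ hK0 hK hz hc0, abs_mul,
    abs_of_nonneg (by positivity : 0 ≤ α / Real.pi), mul_assoc]
  gcongr
  refine (Complex.abs_re_le_norm _).trans ?_
  have hle := norm_integral_le_of_norm_le (μ := volume.restrict (Ioi 0))
    (f := fun y : ℝ ↦ wrightIntegrand α z (c + y * Complex.I))
    ((integrableOn_exp_neg_mul_rpow hα0 hδ).const_mul (Real.exp (K * c ^ α - z * c))) (by
      filter_upwards [ae_restrict_mem measurableSet_Ioi] with y hy
      exact norm_wrightIntegrand_le hK z hc0 (le_of_lt hy))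
  rw [integral_const_mul, hexponent, ← hJ] at hle
  refine hle.trans ?_
  rw [mul_comm]
  gcongr
  linarith
end

section
/- Let 1<α<2 and define Φ_{1/α}(z) = ∑_{m=0}^∞ (−z)^m/(m! Γ(−m/α + 1 − 1/α)). Let g: [0,∞) → ℝ be bounded and measurable with g(s) → 0 as s → ∞. Then t^{−α} ∫_0^∞ Φ_{1/α}(s t^{−α}) g(s) ds → 0 as t → ∞. (This is the step that transfers stabilization from a solution of the fractional diffusion-wave equation to the subordinated solution of the heat equation.) -/
open MeasureTheory Filter Set

theorem norm_cexp_sub_one_le_of_re_nonpos {z : ℂ} (hz : z.re ≤ 0) :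
    ‖Complex.exp z - 1‖ ≤ ‖z‖ := by
  have h := (convex_halfSpace_re_le (0 : ℝ)).norm_image_sub_le_of_norm_hasDerivWithin_le
    (f := Complex.exp) (f' := Complex.exp) (C := 1) (x := 0) (y := z)
    (fun x _ => (Complex.hasDerivAt_exp x).hasDerivWithinAt)
    (fun x hx => by rw [Complex.norm_exp]; exact Real.exp_le_one_iff.2 hx) (by simp) hz
  simpa using h

theorem integrableOn_rpow_mul_exp_neg_mul {s b : ℝ} (hs : -1 < s) (hb : 0 < b) :
    IntegrableOn (fun t : ℝ => t ^ s * Real.exp (-(b * t))) (Ioi 0) := by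
  refine (integrableOn_rpow_mul_exp_neg_mul_rpow hs one_pos hb).congr_fun (fun t _ => ?_)
    measurableSet_Ioi
  simp [Real.rpow_one]

theorem norm_ofReal_rpow_mul_cexp {s t : ℝ} (ht : 0 < t) (q : ℂ) :
    ‖((t ^ s : ℝ) : ℂ) * Complex.exp (-(q * t))‖ = t ^ s * Real.exp (-(q.re * t)) := by
  rw [norm_mul, Complex.norm_exp, Complex.norm_real, Real.norm_of_nonneg (by positivity)]
  simp

theorem integrableOn_rpow_mul_cexp_neg_mul {s : ℝ} (hs : -1 < s) {q : ℂ} (hq : 0 < q.re) :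
    IntegrableOn (fun t : ℝ => ((t ^ s : ℝ) : ℂ) * Complex.exp (-(q * t))) (Ioi 0) := by
  refine (integrableOn_rpow_mul_exp_neg_mul hs hq).mono' (by fun_prop) ?_
  filter_upwards [ae_restrict_mem measurableSet_Ioi] with t ht
  exact (norm_ofReal_rpow_mul_cexp ht q).le

theorem hasDerivAt_integral_rpow_mul_cexp_neg_mul {a : ℝ} (ha : 0 < a) {q : ℂ} (hq : 0 < q.re) :
    HasDerivAt (fun q : ℂ => ∫ t in Ioi (0 : ℝ), ((t ^ (a - 1) : ℝ) : ℂ) * Complex.exp (-(q * t)))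
      (∫ t in Ioi (0 : ℝ), -(((t ^ a : ℝ) : ℂ) * Complex.exp (-(q * t)))) q := by
  have hs : {p : ℂ | q.re / 2 < p.re} ∈ nhds q :=
    (isOpen_lt continuous_const Complex.continuous_re).mem_nhds (by simpa using hq)
  refine (hasDerivAt_integral_of_dominated_loc_of_deriv_le
    (F := fun p t => ((t ^ (a - 1) : ℝ) : ℂ) * Complex.exp (-(p * t)))
    (F' := fun p t => -(((t ^ a : ℝ) : ℂ) * Complex.exp (-(p * t))))
    (bound := fun t => t ^ a * Real.exp (-(q.re / 2 * t))) hs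
    (Eventually.of_forall fun p => by fun_prop)
    (integrableOn_rpow_mul_cexp_neg_mul (by linarith) hq) (by fun_prop) ?_
    (integrableOn_rpow_mul_exp_neg_mul (by linarith) (by positivity)) ?_).2
  · filter_upwards [ae_restrict_mem measurableSet_Ioi] with t ht p hp
    have ht' : 0 < t := ht
    rw [norm_neg, norm_ofReal_rpow_mul_cexp ht]
    have : q.re / 2 < p.re := hp
    gcongr
  · filter_upwards [ae_restrict_mem measurableSet_Ioi] with t ht p _
    have h := (((hasDerivAt_id p).mul_const (t : ℂ)).fun_neg.cexp).const_mul ((t ^ (a - 1) : ℝ) : ℂ)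
    refine h.congr_deriv ?_
    have : t ^ a = t ^ (a - 1) * t := by
      rw [← Real.rpow_add_one (ne_of_gt ht)]; simp
    rw [this]
    push_cast
    simp only [id]
    ring

theorem mul_integral_rpow_mul_cexp_neg_mul {a : ℝ} (ha : 0 < a) {q : ℂ} (hq : 0 < q.re) :
    q * ∫ t in Ioi (0 : ℝ), ((t ^ a : ℝ) : ℂ) * Complex.exp (-(q * t)) =
      a * ∫ t in Ioi (0 : ℝ), ((t ^ (a - 1) : ℝ) : ℂ) * Complex.exp (-(q * t)) := by
  have h₁ := (integrableOn_rpow_mul_cexp_neg_mul (s := a) (by linarith) hq).const_mul q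
  have h₂ := (integrableOn_rpow_mul_cexp_neg_mul (s := a - 1) (by linarith) hq).const_mul (a : ℂ)
  have h := integral_Ioi_of_hasDerivAt_of_tendsto (a := (0 : ℝ)) (m := 0)
    (f := fun t : ℝ => ((t ^ a : ℝ) : ℂ) * Complex.exp (-(q * t))) 
    (f' := fun t : ℝ => a * (((t ^ (a - 1) : ℝ) : ℂ) * Complex.exp (-(q * t))) -
      q * (((t ^ a : ℝ) : ℂ) * Complex.exp (-(q * t)))) ?_ ?_ (h₂.sub h₁) ?_
  · rw [integral_sub h₂ h₁, integral_const_mul, integral_const_mul] at h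
    rw [Real.zero_rpow ha.ne'] at h
    simp only [Complex.ofReal_zero, zero_mul, sub_zero] at h
    exact (sub_eq_zero.1 h).symm
  · have : Continuous fun t : ℝ => t ^ a := Real.continuous_rpow_const ha.le
    exact Continuous.continuousWithinAt (by fun_prop)
  · intro t ht
    have h₁ := (Real.hasDerivAt_rpow_const (p := a) (Or.inl (ne_of_gt ht))).ofReal_comp
    have h₂ := ((((hasDerivAt_id t).ofReal_comp).const_mul q).fun_neg).cexp
    refine (h₁.mul h₂).congr_deriv ?_
    push_cast
    simp only [id]
    ring
  · rw [tendsto_zero_iff_norm_tendsto_zero]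
    refine (tendsto_rpow_mul_exp_neg_mul_atTop_nhds_zero a q.re hq).congr' ?_
    filter_upwards [eventually_gt_atTop 0] with t ht
    rw [norm_ofReal_rpow_mul_cexp ht, neg_mul]

/-- The Gamma integral along a ray in the open right half-plane. -/
theorem cpow_mul_integral_rpow_mul_cexp_neg_mul {a : ℝ} (ha : 0 < a) {q : ℂ} (hq : 0 < q.re) :
    q ^ (a : ℂ) * ∫ t in Ioi (0 : ℝ), ((t ^ (a - 1) : ℝ) : ℂ) * Complex.exp (-(q * t)) =
      Real.Gamma a := by
  have hd : ∀ p : ℂ, 0 < p.re → HasDerivAt (fun q : ℂ => q ^ (a : ℂ) *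
      ∫ t in Ioi (0 : ℝ), ((t ^ (a - 1) : ℝ) : ℂ) * Complex.exp (-(q * t))) 0 p := by
    intro p hp
    have hp0 : p ≠ 0 := by rintro rfl; simp at hp
    refine (((hasDerivAt_id p).cpow_const (Or.inl hp)).mul
      (hasDerivAt_integral_rpow_mul_cexp_neg_mul ha hp)).congr_deriv ?_
    rw [integral_neg]
    simp only [id, mul_one]
    have h := mul_integral_rpow_mul_cexp_neg_mul ha hp
    rw [Complex.cpow_sub _ _ hp0, Complex.cpow_one]
    field_simp
    linear_combination (-p ^ (a : ℂ)) * h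
  have h := (isOpen_lt continuous_const Complex.continuous_re).is_const_of_deriv_eq_zero
    (s := {p : ℂ | 0 < p.re}) (convex_halfSpace_re_gt 0).isPreconnected
    (fun p hp => (hd p hp).differentiableAt.differentiableWithinAt)
    (fun p hp => (hd p hp).deriv) (x := q) (y := 1) hq (by simp)
  rw [h, Real.Gamma_eq_integral ha, Complex.one_cpow, one_mul, ← integral_complex_ofReal]
  refine setIntegral_congr_fun measurableSet_Ioi fun t _ => ?_
  push_cast
  simp [mul_comm]

theorem exists_mul_rpow_le_add_mul {γ : ℝ} (hγ0 : 0 < γ) (hγ1 : γ < 1) {z b : ℝ} (hz : 0 ≤ z)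
    (hb : 0 < b) : ∃ K : ℝ, ∀ t : ℝ, 0 ≤ t → z * t ^ γ ≤ K + b * t := by
  have h1γ : 0 < 1 - γ := by linarith
  set c : ℝ := (z / b ^ γ) ^ (1 / (1 - γ)) with hc
  have hc0 : 0 ≤ c := by positivity
  refine ⟨(1 - γ) * c, fun t ht => ?_⟩
  have h := Real.geom_mean_le_arith_mean2_weighted hγ0.le h1γ.le (p₁ := b * t) (p₂ := c)
    (by positivity) hc0 (by ring)
  have hcγ : c ^ (1 - γ) = z / b ^ γ := by
    rw [hc, ← Real.rpow_mul (by positivity), one_div_mul_cancel h1γ.ne', Real.rpow_one]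
  have hbγ : b ^ γ ≠ 0 := by positivity
  rw [hcγ, Real.mul_rpow hb.le ht] at h
  have e : b ^ γ * t ^ γ * (z / b ^ γ) = z * t ^ γ := by field_simp
  rw [e] at h
  have : 0 ≤ (1 - γ) * (b * t) := by positivity
  nlinarith

theorem integrableOn_rpow_mul_exp_rpow_mul_exp_neg {γ : ℝ} (hγ0 : 0 < γ) (hγ1 : γ < 1) {z b : ℝ}
    (hz : 0 ≤ z) (hb : 0 < b) :
    IntegrableOn (fun t : ℝ => t ^ (γ - 1) * Real.exp (z * t ^ γ) * Real.exp (-(b * t)))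
      (Ioi 0) := by
  obtain ⟨K, hK⟩ := exists_mul_rpow_le_add_mul hγ0 hγ1 hz (half_pos hb)
  refine ((integrableOn_rpow_mul_exp_neg_mul (s := γ - 1) (by linarith)
    (half_pos hb)).const_mul (Real.exp K)).mono' (by fun_prop) ?_
  filter_upwards [ae_restrict_mem measurableSet_Ioi] with t ht
  have ht' : 0 < t := ht
  rw [Real.norm_of_nonneg (by positivity), mul_assoc, ← Real.exp_add, mul_left_comm,
    ← Real.exp_add]
  exact mul_le_mul_of_nonneg_left (Real.exp_le_exp.2 (by linarith [hK t ht'.le])) (by positivity)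

/-- The integrand of the Wright function on a ray, in the variables `w` and `q` given by the
direction of the ray. -/
noncomputable def wrightKernel (γ : ℝ) (w q : ℂ) (z t : ℝ) : ℂ :=
  w * ((t ^ (γ - 1) : ℝ) : ℂ) * Complex.exp (-(z * w * ((t ^ γ : ℝ) : ℂ))) * Complex.exp (-(q * t))

theorem hasSum_integral_wrightKernel {γ : ℝ} (hγ0 : 0 < γ) (hγ1 : γ < 1) {w q : ℂ} (hw : ‖w‖ = 1)
    (hq : 0 < q.re) {z : ℝ} (hz : 0 ≤ z) :
    HasSum (fun m : ℕ => (((-z) ^ m / m.factorial : ℝ) : ℂ) * w ^ (m + 1) *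
      ∫ t in Ioi (0 : ℝ), ((t ^ (γ * (m + 1) - 1) : ℝ) : ℂ) * Complex.exp (-(q * t)))
      (∫ t in Ioi (0 : ℝ), wrightKernel γ w q z t) := by
  have hexp (t : ℝ) : HasSum (fun m : ℕ => t ^ (γ - 1) * ((z * t ^ γ) ^ m / m.factorial) *
      Real.exp (-(q.re * t))) (t ^ (γ - 1) * Real.exp (z * t ^ γ) * Real.exp (-(q.re * t))) := by
    have h := NormedSpace.expSeries_div_hasSum_exp (z * t ^ γ)
    rw [← Real.exp_eq_exp_ℝ] at h
    exact (h.mul_left _).mul_right _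
  have hpow (m : ℕ) {t : ℝ} (ht : 0 < t) :
      t ^ (γ * (m + 1) - 1) = t ^ (γ - 1) * (t ^ γ) ^ m := by
    rw [← Real.rpow_natCast, ← Real.rpow_mul ht.le, ← Real.rpow_add ht]
    ring_nf
  simp_rw [← integral_const_mul]
  refine hasSum_integral_of_dominated_convergence
    (fun m t => t ^ (γ - 1) * ((z * t ^ γ) ^ m / m.factorial) * Real.exp (-(q.re * t)))
    (fun m => by fun_prop) (fun m => ?_) (Eventually.of_forall fun t => (hexp t).summable) ?_ ?_
  · filter_upwards [ae_restrict_mem measurableSet_Ioi] with t ht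
    rw [norm_mul, norm_ofReal_rpow_mul_cexp ht, hpow m ht, norm_mul, norm_pow, hw,
      Complex.norm_real, norm_div, norm_pow, norm_neg, Real.norm_of_nonneg hz,
      Real.norm_of_nonneg (by positivity)]
    apply le_of_eq
    ring
  · simp_rw [(hexp _).tsum_eq]
    exact integrableOn_rpow_mul_exp_rpow_mul_exp_neg hγ0 hγ1 hz hq
  · filter_upwards [ae_restrict_mem measurableSet_Ioi] with t ht
    have h := NormedSpace.expSeries_div_hasSum_exp (-(z * w * ((t ^ γ : ℝ) : ℂ)))
    rw [← Complex.exp_eq_exp_ℂ] at h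
    refine ((h.mul_left (w * ((t ^ (γ - 1) : ℝ) : ℂ))).mul_right
      (Complex.exp (-(q * t)))).congr_fun ?_
    intro m
    rw [hpow m ht]
    push_cast
    ring

theorem hasSum_wrightPhiGamma {γ : ℝ} (hγ0 : 0 < γ) (hγ1 : γ < 1) {ψ : ℝ} (hψ0 : Real.pi / 2 < ψ)
    (hψ1 : ψ < Real.pi) {z : ℝ} (hz : 0 ≤ z) :
    HasSum (fun m : ℕ => (-z) ^ m / ((m.factorial : ℝ) * Real.Gamma (-γ * m + 1 - γ)))
      ((∫ t in Ioi (0 : ℝ), wrightKernel γ (Complex.exp ((ψ * γ : ℝ) * Complex.I))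
        (Complex.exp ((ψ - Real.pi : ℝ) * Complex.I)) z t).im / Real.pi) := by
  have hpi := Real.pi_pos
  have hq : 0 < (Complex.exp ((ψ - Real.pi : ℝ) * Complex.I)).re := by
    rw [Complex.exp_ofReal_mul_I_re]
    exact Real.cos_pos_of_mem_Ioo ⟨by linarith, by linarith⟩
  have h := (Complex.hasSum_im (hasSum_integral_wrightKernel hγ0 hγ1
    (Complex.norm_exp_ofReal_mul_I (ψ * γ)) hq hz)).div_const Real.pi
  refine h.congr_fun fun m => ?_
  set a : ℝ := γ * (m + 1) with ha
  have ha0 : 0 < a := by positivity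
  have hG := cpow_mul_integral_rpow_mul_cexp_neg_mul ha0 hq
  rw [Complex.cpow_def_of_ne_zero (Complex.exp_ne_zero _), Complex.log_exp (by simp; linarith)
    (by simp; linarith)] at hG
  have hI : ∫ t in Ioi (0 : ℝ), ((t ^ (a - 1) : ℝ) : ℂ) *
      Complex.exp (-(Complex.exp ((ψ - Real.pi : ℝ) * Complex.I) * t)) =
      Complex.exp (-((ψ - Real.pi : ℝ) * Complex.I * a)) * Real.Gamma a := by
    rw [← hG, ← mul_assoc, ← Complex.exp_add]
    simp
  have hw : Complex.exp ((ψ * γ : ℝ) * Complex.I) ^ (m + 1) *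
      Complex.exp (-((ψ - Real.pi : ℝ) * Complex.I * a)) =
      Complex.exp ((Real.pi * a : ℝ) * Complex.I) := by
    rw [← Complex.exp_nat_mul, ← Complex.exp_add, ha]
    push_cast
    ring_nf
  rw [hI, ← mul_assoc, mul_assoc _ _ (Complex.exp _), hw, mul_assoc, Complex.im_ofReal_mul,
    Complex.im_mul_ofReal, Complex.exp_ofReal_mul_I_im]
  have hΓ : Real.Gamma a * Real.Gamma (1 - a) = Real.pi / Real.sin (Real.pi * a) :=
    Real.Gamma_mul_Gamma_one_sub a
  have hΓ0 : Real.Gamma a ≠ 0 := (Real.Gamma_pos_of_pos ha0).ne'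
  have hinv : (Real.Gamma (1 - a))⁻¹ = Real.sin (Real.pi * a) * Real.Gamma a / Real.pi := by
    rw [eq_div_of_mul_eq hΓ0 ((mul_comm _ _).trans hΓ), inv_div, div_div_eq_mul_div, mul_comm]
  rw [show -γ * (m : ℝ) + 1 - γ = 1 - a by rw [ha]; ring, div_mul_eq_div_div, div_eq_mul_inv, hinv]
  ring

theorem integrableOn_rpow_mul_cexp_neg_rpow {γ : ℝ} (hγ0 : 0 < γ) {w : ℂ} (hw : 0 < w.re)
    {z : ℝ} (hz : 0 < z) :
    IntegrableOn (fun t : ℝ => w * ((t ^ (γ - 1) : ℝ) : ℂ) *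
      Complex.exp (-(z * w * ((t ^ γ : ℝ) : ℂ)))) (Ioi 0) := by
  refine ((integrableOn_rpow_mul_exp_neg_mul_rpow (s := γ - 1) (by linarith) hγ0
    (mul_pos hz hw)).const_mul ‖w‖).mono' (by fun_prop) ?_
  filter_upwards [ae_restrict_mem measurableSet_Ioi] with t ht
  have ht' : 0 < t := ht
  rw [norm_mul, norm_mul, Complex.norm_exp, Complex.norm_real,
    Real.norm_of_nonneg (by positivity), mul_assoc]
  simp

theorem integral_rpow_mul_cexp_neg_rpow {γ : ℝ} (hγ0 : 0 < γ) {w : ℂ} (hw : 0 < w.re)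
    {z : ℝ} (hz : 0 < z) :
    ∫ t in Ioi (0 : ℝ), w * ((t ^ (γ - 1) : ℝ) : ℂ) * Complex.exp (-(z * w * ((t ^ γ : ℝ) : ℂ))) =
      ((1 / (γ * z) : ℝ) : ℂ) := by
  have hw0 : w ≠ 0 := by rintro rfl; simp at hw
  have hz0 : (z : ℂ) ≠ 0 := by exact_mod_cast hz.ne'
  have hγ : (γ : ℂ) ≠ 0 := by exact_mod_cast hγ0.ne'
  have h₁ := integral_comp_rpow_Ioi_of_pos (g := fun u : ℝ => Complex.exp (-(z * w) * u)) hγ0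
  rw [integral_exp_mul_complex_Ioi (by simpa using mul_pos hz hw)] at h₁
  have h₂ : ∀ t : ℝ, w * ((t ^ (γ - 1) : ℝ) : ℂ) * Complex.exp (-(z * w * ((t ^ γ : ℝ) : ℂ))) =
      w / γ * ((γ * t ^ (γ - 1)) • Complex.exp (-(z * w) * ((t ^ γ : ℝ) : ℂ))) := by
    intro t
    rw [Complex.real_smul, neg_mul]
    push_cast
    field_simp
  simp_rw [h₂]
  rw [integral_const_mul, h₁]
  push_cast
  simp
  field_simp

theorem norm_wrightKernel_le {γ : ℝ} {w q : ℂ} (hw : 0 < w.re) (hw1 : ‖w‖ = 1)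
    {z : ℝ} (hz : 0 ≤ z) {t : ℝ} (ht : 0 < t) :
    ‖wrightKernel γ w q z t‖ ≤ t ^ (γ - 1) * Real.exp (-(q.re * t)) := by
  rw [wrightKernel, mul_right_comm, mul_assoc w, norm_mul, norm_mul w, hw1, one_mul,
    norm_ofReal_rpow_mul_cexp ht, Complex.norm_exp]
  refine mul_le_of_le_one_right (by positivity) (Real.exp_le_one_iff.2 ?_)
  have : 0 ≤ z * w.re * t ^ γ := by positivity
  simpa using this

theorem integrableOn_wrightKernel {γ : ℝ} (hγ0 : 0 < γ) {w q : ℂ} (hw : 0 < w.re) (hw1 : ‖w‖ = 1)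
    (hq : 0 < q.re) {z : ℝ} (hz : 0 ≤ z) :
    IntegrableOn (wrightKernel γ w q z) (Ioi 0) := by
  refine (integrableOn_rpow_mul_exp_neg_mul (s := γ - 1) (by linarith) hq).mono'
    (by unfold wrightKernel; fun_prop) ?_
  filter_upwards [ae_restrict_mem measurableSet_Ioi] with t ht
  exact norm_wrightKernel_le hw hw1 hz ht

theorem abs_im_integral_wrightKernel_le {γ : ℝ} (hγ0 : 0 < γ) {w q : ℂ} (hw : 0 < w.re)
    (hw1 : ‖w‖ = 1) (hq : 0 < q.re) {z : ℝ} (hz : 0 ≤ z) :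
    |(∫ t in Ioi (0 : ℝ), wrightKernel γ w q z t).im| ≤
      ∫ t in Ioi (0 : ℝ), t ^ (γ - 1) * Real.exp (-(q.re * t)) := by
  refine (Complex.abs_im_le_norm _).trans (norm_integral_le_of_norm_le
    (integrableOn_rpow_mul_exp_neg_mul (by linarith) hq) ?_)
  filter_upwards [ae_restrict_mem measurableSet_Ioi] with t ht
  exact norm_wrightKernel_le hw hw1 hz ht

/-- The leading term of the kernel integral is real, so its imaginary part has a faster decay. -/
theorem abs_im_integral_wrightKernel_le_rpow {γ : ℝ} (hγ0 : 0 < γ) {w q : ℂ} (hw : 0 < w.re)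
    (hw1 : ‖w‖ = 1) (hq : 0 < q.re) (hq1 : ‖q‖ = 1) {z : ℝ} (hz : 0 < z) :
    |(∫ t in Ioi (0 : ℝ), wrightKernel γ w q z t).im| ≤
      w.re ^ (-(γ + 1) / γ) * (1 / γ) * Real.Gamma ((γ + 1) / γ) * z ^ (-(γ + 1) / γ) := by
  have hi := integrableOn_rpow_mul_cexp_neg_rpow hγ0 hw hz
  have him : (∫ t in Ioi (0 : ℝ), wrightKernel γ w q z t).im =
      (∫ t in Ioi (0 : ℝ), (wrightKernel γ w q z t -
        w * ((t ^ (γ - 1) : ℝ) : ℂ) * Complex.exp (-(z * w * ((t ^ γ : ℝ) : ℂ))))).im := by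
    rw [integral_sub (integrableOn_wrightKernel hγ0 hw hw1 hq hz.le) hi,
      integral_rpow_mul_cexp_neg_rpow hγ0 hw hz, Complex.sub_im, Complex.ofReal_im, sub_zero]
  have hgauss := integral_rpow_mul_exp_neg_mul_rpow hγ0 (q := γ) (by linarith) (mul_pos hz hw)
  rw [Real.mul_rpow hz.le hw.le] at hgauss
  rw [him]
  refine (Complex.abs_im_le_norm _).trans ((norm_integral_le_of_norm_le
    (integrableOn_rpow_mul_exp_neg_mul_rpow (s := γ) (by linarith) hγ0 (mul_pos hz hw)) ?_).trans
      (hgauss.trans (by ring)).le)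
  filter_upwards [ae_restrict_mem measurableSet_Ioi] with t ht
  have ht' : 0 < t := ht
  have hq' : ‖Complex.exp (-(q * t)) - 1‖ ≤ t := by
    refine (norm_cexp_sub_one_le_of_re_nonpos ?_).trans_eq ?_
    · simpa using (mul_pos hq ht').le
    · rw [norm_neg, norm_mul, hq1, Complex.norm_real, Real.norm_of_nonneg ht'.le, one_mul]
  have hpow : t ^ γ = t ^ (γ - 1) * t := by
    rw [← Real.rpow_add_one ht'.ne']; simp
  rw [wrightKernel, ← mul_sub_one, norm_mul, norm_mul, norm_mul, hw1, one_mul, Complex.norm_real,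
    Real.norm_of_nonneg (by positivity), Complex.norm_exp]
  calc _ ≤ t ^ (γ - 1) * Real.exp (-(z * w * ((t ^ γ : ℝ) : ℂ))).re * t := by gcongr
    _ = (t ^ (γ - 1) * t) * Real.exp (-(z * w * ((t ^ γ : ℝ) : ℂ))).re := by ring
    _ = _ := by rw [← hpow]; simp

theorem integrableOn_wrightPhiGamma {γ : ℝ} (hγ0 : 0 < γ) (hγ1 : γ < 1) :
    IntegrableOn (wrightPhiGamma γ) (Ioi 0) := by
  have hpi := Real.pi_pos
  obtain ⟨ψ, hψ0, hψ⟩ : ∃ ψ, Real.pi / 2 < ψ ∧ ψ < min Real.pi (Real.pi / 2 / γ) :=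
    exists_between (lt_min (by linarith) ((lt_div_iff₀ hγ0).2 (by nlinarith)))
  have hψ1 := hψ.trans_le (min_le_left _ _)
  have hψγ : ψ * γ < Real.pi / 2 := (lt_div_iff₀ hγ0).1 (hψ.trans_le (min_le_right _ _))
  have hψγ0 : 0 < ψ * γ := mul_pos (by linarith) hγ0
  have hsum (z : ℝ) (hz : 0 ≤ z) := hasSum_wrightPhiGamma hγ0 hγ1 hψ0 hψ1 hz
  set w : ℂ := Complex.exp ((ψ * γ : ℝ) * Complex.I) with hw_def
  set q : ℂ := Complex.exp ((ψ - Real.pi : ℝ) * Complex.I) with hq_def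
  have hw1 : ‖w‖ = 1 := Complex.norm_exp_ofReal_mul_I _
  have hq1 : ‖q‖ = 1 := Complex.norm_exp_ofReal_mul_I _
  have hw : 0 < w.re := by
    rw [hw_def, Complex.exp_ofReal_mul_I_re]
    exact Real.cos_pos_of_mem_Ioo ⟨by linarith, by linarith⟩
  have hq : 0 < q.re := by
    rw [hq_def, Complex.exp_ofReal_mul_I_re]
    exact Real.cos_pos_of_mem_Ioo ⟨by linarith, by linarith⟩
  have heq (z : ℝ) (hz : 0 ≤ z) : |wrightPhiGamma γ z| =
      |(∫ t in Ioi (0 : ℝ), wrightKernel γ w q z t).im| / Real.pi := by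
    rw [wrightPhiGamma, (hsum z hz).tsum_eq, abs_div, abs_of_pos hpi]
  have hmeas : AEStronglyMeasurable (wrightPhiGamma γ) (volume.restrict (Ioi 0)) := by
    refine aestronglyMeasurable_of_tendsto_ae atTop (f := fun n z => ∑ m ∈ Finset.range n,
      (-z) ^ m / ((m.factorial : ℝ) * Real.Gamma (-γ * m + 1 - γ))) (fun n => by fun_prop) ?_
    filter_upwards [ae_restrict_mem measurableSet_Ioi] with z hz
    exact (hsum z (le_of_lt hz)).summable.hasSum.tendsto_sum_nat
  rw [← Ioc_union_Ioi_eq_Ioi zero_le_one]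
  refine IntegrableOn.union ?_ ?_
  · refine Integrable.mono' (integrable_const
      ((∫ t in Ioi (0 : ℝ), t ^ (γ - 1) * Real.exp (-(q.re * t))) / Real.pi))
      (hmeas.mono_measure (Measure.restrict_mono Ioc_subset_Ioi_self le_rfl)) ?_
    filter_upwards [ae_restrict_mem measurableSet_Ioc] with z hz
    rw [Real.norm_eq_abs, heq z hz.1.le]
    gcongr
    exact abs_im_integral_wrightKernel_le hγ0 hw hw1 hq hz.1.le
  · have hexp : -(γ + 1) / γ < -1 := by
      rw [div_lt_iff₀ hγ0]; linarith
    refine (((integrableOn_Ioi_rpow_of_lt hexp one_pos).const_mul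
      (w.re ^ (-(γ + 1) / γ) * (1 / γ) * Real.Gamma ((γ + 1) / γ))).div_const Real.pi).mono'
      (hmeas.mono_measure (Measure.restrict_mono (Ioi_subset_Ioi zero_le_one) le_rfl)) ?_
    filter_upwards [ae_restrict_mem measurableSet_Ioi] with z hz
    have hz0 : 0 < z := one_pos.trans hz
    rw [Real.norm_eq_abs, heq z hz0.le]
    gcongr
    exact abs_im_integral_wrightKernel_le_rpow hγ0 hw hw1 hq hq1 hz0

/-- Averages of a bounded function vanishing at infinity against dilations of an integrable kernel
tend to zero. -/
theorem tendsto_rpow_neg_mul_integral_comp_mul {f g : ℝ → ℝ} (hf : IntegrableOn f (Ioi 0))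
    (hgmeas : Measurable g) {M : ℝ} (hgbd : ∀ s, |g s| ≤ M) (hg : Tendsto g atTop (nhds 0))
    {α : ℝ} (hα : 0 < α) :
    Tendsto (fun t : ℝ => t ^ (-α) * ∫ s in Ioi (0 : ℝ), f (s * t ^ (-α)) * g s)
      atTop (nhds 0) := by
  have h : Tendsto (fun t : ℝ => ∫ u in Ioi (0 : ℝ), f u * g (u * t ^ α)) atTop
      (nhds (∫ _ in Ioi (0 : ℝ), (0 : ℝ))) := by
    refine MeasureTheory.tendsto_integral_filter_of_dominated_convergence (fun u => ‖f u‖ * M)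
      (Eventually.of_forall fun t => hf.aestronglyMeasurable.mul
        (hgmeas.comp (measurable_id.mul_const _)).aestronglyMeasurable)
      (Eventually.of_forall fun t => Eventually.of_forall fun u => ?_) (hf.norm.mul_const M) ?_
    · rw [norm_mul]
      exact mul_le_mul_of_nonneg_left (hgbd _) (norm_nonneg _)
    · filter_upwards [ae_restrict_mem measurableSet_Ioi] with u hu
      simpa using (hg.comp ((tendsto_rpow_atTop hα).const_mul_atTop hu)).const_mul (f u)
  rw [integral_zero] at h
  refine h.congr' ?_
  filter_upwards [eventually_gt_atTop 0] with t ht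
  have hpos : 0 < t ^ (-α) := by positivity
  have hc := integral_comp_mul_right_Ioi (fun u => f u * g (u * t ^ α)) 0 hpos
  have hinv : t ^ (-α) * t ^ α = 1 := by
    rw [← Real.rpow_add ht]; simp
  simp only [mul_assoc, hinv, mul_one, zero_mul, smul_eq_mul] at hc
  rw [hc, mul_inv_cancel_left₀ hpos.ne']

/-- Subordination step: if `g` is bounded, measurable and `g(s) → 0` as `s → ∞`, then
`t^{-α} ∫_0^∞ Φ_{1/α}(s t^{-α}) g(s) ds → 0` as `t → ∞`. -/
theorem subordination_transfers_stabilization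
    (α : ℝ) (hα₁ : 1 < α) (hα₂ : α < 2)
    (g : ℝ → ℝ) (hgmeas : Measurable g) (M : ℝ) (hgbd : ∀ s, |g s| ≤ M)
    (hg : Tendsto g atTop (nhds 0)) :
    Tendsto (fun t : ℝ => t ^ (-α) * ∫ s in Ioi (0 : ℝ), wrightPhiGamma (1 / α) (s * t ^ (-α)) * g s)
      atTop (nhds 0) := by
  exact tendsto_rpow_neg_mul_integral_comp_mul
    (integrableOn_wrightPhiGamma (one_div_pos.2 (by linarith)) ((div_lt_one (by linarith)).2 hα₁))
    hgmeas hgbd hg (by linarith)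
end
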